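/- arXiv:0807.0367 — 2 statements merged into one kernel-verified Lean document; each statement's English description precedes it below -/
import Mathlib

section
/- Quadratic Morawetz identity for NLS: let h : ℝⁿ → ℝ be a smooth even function all of whose derivatives of order ≥ 1 are bounded, and let u be a smooth decaying solution of the NLS equation. Then M(t) is differentiable in t and M'(t) = (1/2)⟨∇ρ(t), Δh ⋆ ∇ρ(t)⟩ + ⟨ρ(t), Δh ⋆ (ρ g(ρ) - G(ρ))(t)⟩ + R(t), where R(t) = (1/2)∫∫ Σ_{k,l=1}^n ∂_k∂_l h(x-y) · conj(w_k(x,y)) · w_l(x,y) dx dy with w(x,y) = u(t,x)∇u(t,y) - u(t,y)∇u(t,x) ∈ ℂⁿ. In particular, if the Hessian ∇²h(z) is positive semidefinite for every z, then R(t) ≥ 0. -/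
open MeasureTheory Filter Complex

noncomputable section

/-- `ℝⁿ` as a Euclidean space. -/
abbrev Ed (n : ℕ) := EuclideanSpace ℝ (Fin n)

/-- Spatial partial derivative `∂_k` of a complex-valued function. -/
def pd {n : ℕ} (k : Fin n) (f : Ed n → ℂ) (x : Ed n) : ℂ :=
  fderiv ℝ f x (EuclideanSpace.single k 1)

/-- Spatial partial derivative `∂_k` of a real-valued function. -/
def pdR {n : ℕ} (k : Fin n) (f : Ed n → ℝ) (x : Ed n) : ℝ :=
  fderiv ℝ f x (EuclideanSpace.single k 1)

/-- Spatial Laplacian of a complex-valued function. -/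
def lapC {n : ℕ} (f : Ed n → ℂ) (x : Ed n) : ℂ := ∑ k, pd k (fun y => pd k f y) x

/-- Spatial Laplacian of a real-valued function. -/
def lapR {n : ℕ} (f : Ed n → ℝ) (x : Ed n) : ℝ := ∑ k, pdR k (fun y => pdR k f y) x

/-- Second partial derivative `∂_k ∂_l h`. -/
def hess {n : ℕ} (h : Ed n → ℝ) (k l : Fin n) (x : Ed n) : ℝ :=
  pdR k (fun y => pdR l h y) x

/-- `u(t,·)` and all its space-time derivatives are Schwartz in `x`,
uniformly for `t` in compact intervals. -/
def SchwartzDecay {n : ℕ} (u : ℝ → Ed n → ℂ) : Prop :=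
  ∀ (N m : ℕ) (a b : ℝ), ∃ C : ℝ, ∀ t ∈ Set.Icc a b, ∀ x : Ed n,
    (1 + ‖x‖) ^ m * ‖iteratedFDeriv ℝ N (fun p : ℝ × Ed n => u p.1 p.2) (t, x)‖ ≤ C

/-- A smooth decaying solution of the NLS equation `i ∂_t u = -(1/2) Δu + g(|u|²) u`. -/
def IsNLSSolution {n : ℕ} (g : ℝ → ℝ) (u : ℝ → Ed n → ℂ) : Prop :=
  ContDiff ℝ (⊤ : ℕ∞) (fun p : ℝ × Ed n => u p.1 p.2) ∧ SchwartzDecay u ∧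
    ∀ t x, Complex.I * deriv (fun s => u s x) t =
      -(1/2) * lapC (u t) x + ((g (‖u t x‖ ^ 2) : ℝ) : ℂ) * u t x

/-- Mass density `ρ = |u|²`. -/
def dens {n : ℕ} (u : ℝ → Ed n → ℂ) (t : ℝ) (x : Ed n) : ℝ := ‖u t x‖ ^ 2

/-- Mass current `j = Im (ū ∇u)`, `k`-th component. -/
def curr {n : ℕ} (u : ℝ → Ed n → ℂ) (k : Fin n) (t : ℝ) (x : Ed n) : ℝ :=
  ((starRingEnd ℂ) (u t x) * pd k (u t) x).im

/-- The Morawetz quantity `M(t) = -⟨ρ(t), ∇h ⋆ j(t)⟩`. -/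
def morawetzM {n : ℕ} (h : Ed n → ℝ) (u : ℝ → Ed n → ℂ) (t : ℝ) : ℝ :=
  -∫ x, ∫ y, dens u t x * ∑ k, pdR k h (x - y) * curr u k t y

/-- The commutator vector `w(x,y) = u(t,x)∇u(t,y) - u(t,y)∇u(t,x)`, `k`-th component. -/
def wVec {n : ℕ} (u : ℝ → Ed n → ℂ) (t : ℝ) (x y : Ed n) (k : Fin n) : ℂ :=
  u t x * pd k (u t) y - u t y * pd k (u t) x

/-- The positive-definite remainder
`R(t) = (1/2)∫∫ ∑_{k,l} ∂_k∂_l h(x-y) conj(w_k(x,y)) w_l(x,y) dx dy`. -/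
def morawetzR {n : ℕ} (h : Ed n → ℝ) (u : ℝ → Ed n → ℂ) (t : ℝ) : ℝ :=
  (1/2) * ∫ x, ∫ y,
    (∑ k, ∑ l, (hess h k l (x - y) : ℂ) *
      ((starRingEnd ℂ) (wVec u t x y k) * wVec u t x y l)).re

/-- The derivative of `F` in the direction `v`, as a function. -/
def dirDeriv {E : Type*} [NormedAddCommGroup E] [NormedSpace ℝ E] (v : E) (F : E → ℝ) : E → ℝ :=
  fun p => fderiv ℝ F p v

section DirDeriv

variable {E : Type*} [NormedAddCommGroup E] [NormedSpace ℝ E] {F H : E → ℝ}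

lemma ContDiff.dirDeriv (hF : ContDiff ℝ (⊤ : ℕ∞) F) (v : E) :
    ContDiff ℝ (⊤ : ℕ∞) (dirDeriv v F) :=
  (hF.fderiv_right (m := (⊤ : ℕ∞)) (by simp)).clm_apply contDiff_const

lemma norm_iteratedFDeriv_dirDeriv_le (hF : ContDiff ℝ (⊤ : ℕ∞) F) (v : E) (N : ℕ) (p : E) :
    ‖iteratedFDeriv ℝ N (dirDeriv v F) p‖ ≤ ‖v‖ * ‖iteratedFDeriv ℝ (N + 1) F p‖ := by
  rw [← norm_iteratedFDeriv_fderiv]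
  exact norm_iteratedFDeriv_clm_apply_const
    (hF.fderiv_right (m := (⊤ : ℕ∞)) (by simp)).contDiffAt (by exact_mod_cast le_top)

lemma dirDeriv_comm (hF : ContDiff ℝ (⊤ : ℕ∞) F) (v w : E) :
    dirDeriv v (dirDeriv w F) = dirDeriv w (dirDeriv v F) := by
  have hd : Differentiable ℝ (fderiv ℝ F) :=
    (hF.fderiv_right (m := (⊤ : ℕ∞)) (by simp)).differentiable (by simp)
  have key : ∀ (a b p : E), dirDeriv a (dirDeriv b F) p = fderiv ℝ (fderiv ℝ F) p a b := by
    intro a b p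
    unfold dirDeriv
    rw [fderiv_clm_apply (hd p) (differentiableAt_const b)]
    simp
  funext p
  rw [key, key]
  exact second_derivative_symmetric
    (fun y => (hF.differentiable (by simp) y).hasFDerivAt) (hd p).hasFDerivAt v w

lemma dirDeriv_add (hF : Differentiable ℝ F) (hH : Differentiable ℝ H) (v : E) :
    dirDeriv v (fun p => F p + H p) = fun p => dirDeriv v F p + dirDeriv v H p := by
  funext p
  simp [dirDeriv, fderiv_fun_add (hF p) (hH p)]

lemma dirDeriv_sub (hF : Differentiable ℝ F) (hH : Differentiable ℝ H) (v : E) :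
    dirDeriv v (fun p => F p - H p) = fun p => dirDeriv v F p - dirDeriv v H p := by
  funext p
  simp [dirDeriv, fderiv_fun_sub (hF p) (hH p)]

lemma dirDeriv_mul (hF : Differentiable ℝ F) (hH : Differentiable ℝ H) (v : E) :
    dirDeriv v (fun p => F p * H p) = fun p => dirDeriv v F p * H p + F p * dirDeriv v H p := by
  funext p
  simp [dirDeriv, fderiv_fun_mul (hF p) (hH p)]
  ring

lemma dirDeriv_const_mul (hF : Differentiable ℝ F) (c : ℝ) (v : E) :
    dirDeriv v (fun p => c * F p) = fun p => c * dirDeriv v F p := by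
  funext p
  simp [dirDeriv, fderiv_const_mul (hF p)]

lemma dirDeriv_sum {ι : Type*} {s : Finset ι} {F : ι → E → ℝ} (hF : ∀ i, Differentiable ℝ (F i))
    (v : E) : dirDeriv v (fun p => ∑ i ∈ s, F i p) = fun p => ∑ i ∈ s, dirDeriv v (F i) p := by
  funext p
  simp [dirDeriv, fderiv_fun_sum (fun i _ => hF i p)]

lemma dirDeriv_comp {φ φ' : ℝ → ℝ} (hφ : ∀ r, HasDerivAt φ (φ' r) r) (hF : Differentiable ℝ F)
    (v : E) : dirDeriv v (fun p => φ (F p)) = fun p => φ' (F p) * dirDeriv v F p := by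
  funext p
  have := ((hφ (F p)).comp_hasFDerivAt p (hF p).hasFDerivAt).fderiv
  simp only [Function.comp_def] at this
  simp [dirDeriv, this]

end DirDeriv

/-- A smooth real function of space-time which is, with all its derivatives, rapidly decaying in
space, uniformly for times in compact intervals. -/
def IsDecaying {n : ℕ} (F : ℝ × Ed n → ℝ) : Prop :=
  ContDiff ℝ (⊤ : ℕ∞) F ∧ ∀ (N m : ℕ) (a b : ℝ), ∃ C : ℝ, ∀ t ∈ Set.Icc a b, ∀ x : Ed n,
    (1 + ‖x‖) ^ m * ‖iteratedFDeriv ℝ N F (t, x)‖ ≤ C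

namespace IsDecaying

variable {n : ℕ} {F H : ℝ × Ed n → ℝ}

lemma differentiable (hF : IsDecaying F) : Differentiable ℝ F := hF.1.differentiable (by simp)

lemma dirDeriv (hF : IsDecaying F) (v : ℝ × Ed n) : IsDecaying (dirDeriv v F) := by
  refine ⟨hF.1.dirDeriv v, fun N m a b => ?_⟩
  obtain ⟨C, hC⟩ := hF.2 (N + 1) m a b
  refine ⟨‖v‖ * C, fun t ht x => ?_⟩
  calc _ ≤ (1 + ‖x‖) ^ m * (‖v‖ * ‖iteratedFDeriv ℝ (N + 1) F (t, x)‖) := by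
        gcongr; exact norm_iteratedFDeriv_dirDeriv_le hF.1 v N _
    _ = ‖v‖ * ((1 + ‖x‖) ^ m * ‖iteratedFDeriv ℝ (N + 1) F (t, x)‖) := by ring
    _ ≤ _ := by gcongr; exact hC t ht x

lemma add (hF : IsDecaying F) (hH : IsDecaying H) : IsDecaying (fun p => F p + H p) := by
  refine ⟨hF.1.add hH.1, fun N m a b => ?_⟩
  obtain ⟨C, hC⟩ := hF.2 N m a b
  obtain ⟨D, hD⟩ := hH.2 N m a b
  refine ⟨C + D, fun t ht x => ?_⟩
  have : iteratedFDeriv ℝ N (fun p => F p + H p) (t, x)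
      = iteratedFDeriv ℝ N F (t, x) + iteratedFDeriv ℝ N H (t, x) :=
    iteratedFDeriv_add_apply (hF.1.of_le (by exact_mod_cast le_top)).contDiffAt
      (hH.1.of_le (by exact_mod_cast le_top)).contDiffAt
  rw [this]
  calc _ ≤ (1 + ‖x‖) ^ m * (‖iteratedFDeriv ℝ N F (t, x)‖ + ‖iteratedFDeriv ℝ N H (t, x)‖) := by
        gcongr; exact norm_add_le _ _
    _ ≤ _ := by rw [mul_add]; exact add_le_add (hC t ht x) (hD t ht x)

lemma mul (hF : IsDecaying F) (hH : IsDecaying H) : IsDecaying (fun p => F p * H p) := by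
  refine ⟨hF.1.mul hH.1, fun N m a b => ?_⟩
  choose C hC using fun i => hF.2 i m a b
  choose D hD using fun i => hH.2 i 0 a b
  refine ⟨∑ i ∈ Finset.range (N + 1), (N.choose i : ℝ) * C i * D (N - i), fun t ht x => ?_⟩
  calc _ ≤ (1 + ‖x‖) ^ m * ∑ i ∈ Finset.range (N + 1), (N.choose i : ℝ) *
        ‖iteratedFDeriv ℝ i F (t, x)‖ * ‖iteratedFDeriv ℝ (N - i) H (t, x)‖ := by
        gcongr; exact norm_iteratedFDeriv_mul_le hF.1 hH.1 _ (by exact_mod_cast le_top)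
    _ = ∑ i ∈ Finset.range (N + 1), (N.choose i : ℝ) *
        ((1 + ‖x‖) ^ m * ‖iteratedFDeriv ℝ i F (t, x)‖) *
          ‖iteratedFDeriv ℝ (N - i) H (t, x)‖ := by
        rw [Finset.mul_sum]; exact Finset.sum_congr rfl fun i _ => by ring
    _ ≤ _ := by
        refine Finset.sum_le_sum fun i _ => ?_
        have h1 := hC i t ht x
        have h2 := hD (N - i) t ht x
        simp only [pow_zero, one_mul] at h2
        have h3 : 0 ≤ C i := le_trans (by positivity) h1
        gcongr

lemma const_mul (hF : IsDecaying F) (c : ℝ) : IsDecaying (fun p => c * F p) := by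
  refine ⟨contDiff_const.mul hF.1, fun N m a b => ?_⟩
  obtain ⟨C, hC⟩ := hF.2 N m a b
  refine ⟨|c| * C, fun t ht x => ?_⟩
  have : iteratedFDeriv ℝ N (fun p => c * F p) (t, x) = c • iteratedFDeriv ℝ N F (t, x) :=
    iteratedFDeriv_const_smul_apply (a := c) (f := F)
      (hF.1.of_le (by exact_mod_cast le_top)).contDiffAt
  rw [this, norm_smul, Real.norm_eq_abs, mul_left_comm]
  gcongr
  exact hC t ht x

lemma sub (hF : IsDecaying F) (hH : IsDecaying H) : IsDecaying (fun p => F p - H p) := by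
  simpa [sub_eq_add_neg] using hF.add (hH.const_mul (-1))

lemma zero : IsDecaying (fun _ : ℝ × Ed n => 0) :=
  ⟨contDiff_const, fun N m a b => ⟨0, fun t _ x => by simp⟩⟩

lemma sum {ι : Type*} {s : Finset ι} {F : ι → ℝ × Ed n → ℝ} (hF : ∀ i, IsDecaying (F i)) :
    IsDecaying (fun p => ∑ i ∈ s, F i p) := by
  classical
  induction s using Finset.induction_on with
  | empty => simpa using zero
  | insert i s hi ih => simpa [Finset.sum_insert hi] using (hF i).add ih

lemma exists_bound (hF : IsDecaying F) (a b : ℝ) :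
    ∃ C : ℝ, 0 ≤ C ∧ ∀ t ∈ Set.Icc a b, ∀ x,
      |F (t, x)| ≤ C * (1 + ‖x‖) ^ (-((n + 1 : ℕ) : ℝ)) := by
  obtain ⟨C, hC⟩ := hF.2 0 (n + 1) a b
  refine ⟨max C 0, le_max_right _ _, fun t ht x => ?_⟩
  have h1 := hC t ht x
  have h2 : 0 < 1 + ‖x‖ := by positivity
  rw [Real.rpow_neg h2.le, Real.rpow_natCast, ← div_eq_mul_inv, le_div_iff₀ (by positivity)]
  rw [norm_iteratedFDeriv_zero, Real.norm_eq_abs, mul_comm] at h1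
  exact h1.trans (le_max_left _ _)

end IsDecaying

lemma integrable_weight (n : ℕ) :
    Integrable (fun x : Ed n => (1 + ‖x‖) ^ (-((n + 1 : ℕ) : ℝ))) :=
  integrable_one_add_norm (by simp)

namespace IsDecaying

variable {n : ℕ} {F H : ℝ × Ed n → ℝ}

lemma integrable (hF : IsDecaying F) (t : ℝ) : Integrable (fun x => F (t, x)) := by
  obtain ⟨C, -, hC⟩ := hF.exists_bound t t
  have hc : Continuous fun x => F (t, x) := hF.1.continuous.comp (by fun_prop)
  refine ((integrable_weight n).const_mul C).mono' hc.aestronglyMeasurable ?_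
  exact ae_of_all _ fun x => hC t (by simp) x

lemma bounded (hF : IsDecaying F) (t : ℝ) : ∃ C : ℝ, ∀ x, |F (t, x)| ≤ C := by
  obtain ⟨C, hC⟩ := hF.2 0 0 t t
  exact ⟨C, fun x => by simpa using hC t (by simp) x⟩

lemma slice_differentiable (hF : IsDecaying F) (t : ℝ) : Differentiable ℝ (fun x => F (t, x)) :=
  hF.differentiable.comp (by fun_prop)

end IsDecaying

/-- The time direction in space-time. -/
def timeDir (n : ℕ) : ℝ × Ed n := (1, 0)

/-- The `k`-th spatial direction in space-time. -/
def spaceDir {n : ℕ} (k : Fin n) : ℝ × Ed n := (0, EuclideanSpace.single k 1)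

lemma fderiv_slice_space {n : ℕ} {V : Type*} [NormedAddCommGroup V] [NormedSpace ℝ V]
    {F : ℝ × Ed n → V} (hF : Differentiable ℝ F) (k : Fin n) (t : ℝ) (x : Ed n) :
    fderiv ℝ (fun y => F (t, y)) x (EuclideanSpace.single k 1)
      = fderiv ℝ F (t, x) (spaceDir k) := by
  have h1 : HasFDerivAt (fun y : Ed n => (t, y)) (ContinuousLinearMap.inr ℝ ℝ (Ed n)) x :=
    hasFDerivAt_prodMk_right t x
  have h2 := ((hF (t, x)).hasFDerivAt.comp x h1).fderiv
  simp only [Function.comp_def] at h2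
  simp [h2, spaceDir]

lemma hasDerivAt_slice_time {n : ℕ} {V : Type*} [NormedAddCommGroup V] [NormedSpace ℝ V]
    {F : ℝ × Ed n → V} (hF : Differentiable ℝ F) (t : ℝ) (x : Ed n) :
    HasDerivAt (fun s => F (s, x)) (fderiv ℝ F (t, x) (timeDir n)) t := by
  have h1 : HasFDerivAt (fun s : ℝ => (s, x)) (ContinuousLinearMap.inl ℝ ℝ (Ed n)) t :=
    hasFDerivAt_prodMk_left t x
  have h2 := ((hF (t, x)).hasFDerivAt.comp t h1).hasDerivAt
  simpa [timeDir, Function.comp_def] using h2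

/-- A smooth function which is bounded together with all its derivatives. -/
def IsSmoothBdd {n : ℕ} (k : Ed n → ℝ) : Prop :=
  ContDiff ℝ (⊤ : ℕ∞) k ∧ ∀ i : ℕ, ∃ C : ℝ, ∀ x, ‖iteratedFDeriv ℝ i k x‖ ≤ C

lemma isSmoothBdd_dirDeriv_of_bounded {n : ℕ} {h : Ed n → ℝ} (hs : ContDiff ℝ (⊤ : ℕ∞) h)
    (hb : ∀ i : ℕ, 1 ≤ i → ∃ C : ℝ, ∀ x, ‖iteratedFDeriv ℝ i h x‖ ≤ C) (v : Ed n) :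
    IsSmoothBdd (dirDeriv v h) := by
  refine ⟨hs.dirDeriv v, fun i => ?_⟩
  obtain ⟨C, hC⟩ := hb (i + 1) (by omega)
  refine ⟨‖v‖ * C, fun x => (norm_iteratedFDeriv_dirDeriv_le hs v i x).trans ?_⟩
  gcongr
  exact hC x

namespace IsSmoothBdd

variable {n : ℕ} {k : Ed n → ℝ}

lemma dirDeriv (hk : IsSmoothBdd k) (v : Ed n) : IsSmoothBdd (dirDeriv v k) :=
  isSmoothBdd_dirDeriv_of_bounded hk.1 (fun i _ => hk.2 i) v

lemma bounded (hk : IsSmoothBdd k) : ∃ C : ℝ, 0 ≤ C ∧ ∀ x, |k x| ≤ C := by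
  obtain ⟨C, hC⟩ := hk.2 0
  exact ⟨C, (norm_nonneg _).trans (hC 0), fun x => by simpa using hC x⟩

lemma differentiable (hk : IsSmoothBdd k) : Differentiable ℝ k := hk.1.differentiable (by simp)

end IsSmoothBdd

/-- The pairing `⟨f, k ⋆ g⟩`. -/
def pairing {n : ℕ} (k f g : Ed n → ℝ) : ℝ :=
  ∫ z : Ed n × Ed n, f z.1 * k (z.1 - z.2) * g z.2

section Pairing

variable {n : ℕ} {k f g : Ed n → ℝ}

lemma integrable_kernel_mul {τ : Ed n → Ed n} (hk : IsSmoothBdd k) (hτ : Continuous τ)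
    (hf : Integrable f) : Integrable fun x => k (τ x) * f x := by
  obtain ⟨C, -, hC⟩ := hk.bounded
  exact hf.bdd_mul (c := C) (hk.1.continuous.comp hτ).aestronglyMeasurable
    (ae_of_all _ fun x => hC _)

lemma integrable_pairing (hk : IsSmoothBdd k) (hf : Integrable f) (hg : Integrable g) :
    Integrable (fun z : Ed n × Ed n => f z.1 * k (z.1 - z.2) * g z.2) := by
  obtain ⟨C, -, hC⟩ := hk.bounded
  have hc : Continuous fun z : Ed n × Ed n => k (z.1 - z.2) := hk.1.continuous.comp (by fun_prop)
  have := (hf.mul_prod hg).bdd_mul (c := C) hc.aestronglyMeasurable (ae_of_all _ fun z => hC _)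
  exact this.congr (ae_of_all _ fun z => by ring)

lemma integral_integral_eq_pairing (hk : IsSmoothBdd k) (hf : Integrable f) (hg : Integrable g) :
    ∫ x, ∫ y, f x * k (x - y) * g y = pairing k f g :=
  integral_integral (f := fun x y => f x * k (x - y) * g y) (integrable_pairing hk hf hg)

lemma pairing_const_mul_left (c : ℝ) :
    pairing k (fun x => c * f x) g = c * pairing k f g := by
  unfold pairing
  rw [← integral_const_mul]
  exact integral_congr_ae (ae_of_all _ fun z => by ring)

lemma pairing_sum_left {ι : Type*} {s : Finset ι} {f : ι → Ed n → ℝ} (hk : IsSmoothBdd k)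
    (hf : ∀ i, Integrable (f i)) (hg : Integrable g) :
    pairing k (fun x => ∑ i ∈ s, f i x) g = ∑ i ∈ s, pairing k (f i) g := by
  unfold pairing
  rw [← integral_finsetSum s fun i _ => integrable_pairing hk (hf i) hg]
  exact integral_congr_ae (ae_of_all _ fun z => by simp only [Finset.sum_mul])

lemma pairing_add_right {g₁ g₂ : Ed n → ℝ} (hk : IsSmoothBdd k) (hf : Integrable f)
    (hg₁ : Integrable g₁) (hg₂ : Integrable g₂) :
    pairing k f (fun x => g₁ x + g₂ x) = pairing k f g₁ + pairing k f g₂ := by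
  unfold pairing
  rw [← integral_add (integrable_pairing hk hf hg₁) (integrable_pairing hk hf hg₂)]
  exact integral_congr_ae (ae_of_all _ fun z => by ring)

lemma pairing_const_mul_right (c : ℝ) :
    pairing k f (fun x => c * g x) = c * pairing k f g := by
  unfold pairing
  rw [← integral_const_mul]
  exact integral_congr_ae (ae_of_all _ fun z => by ring)

lemma pairing_sum_right {ι : Type*} {s : Finset ι} {g : ι → Ed n → ℝ} (hk : IsSmoothBdd k)
    (hf : Integrable f) (hg : ∀ i, Integrable (g i)) :
    pairing k f (fun x => ∑ i ∈ s, g i x) = ∑ i ∈ s, pairing k f (g i) := by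
  unfold pairing
  rw [← integral_finsetSum s fun i _ => integrable_pairing hk hf (hg i)]
  exact integral_congr_ae (ae_of_all _ fun z => by simp only [Finset.mul_sum])

lemma pairing_symm (hk : ∀ x, k (-x) = k x) : pairing k f g = pairing k g f := by
  unfold pairing
  rw [Measure.volume_eq_prod, ← integral_prod_swap]
  refine integral_congr_ae (ae_of_all _ fun z => ?_)
  simp only [Prod.fst_swap, Prod.snd_swap]
  rw [← hk, neg_sub]
  ring

lemma pairing_dirDeriv_right (hk : IsSmoothBdd k) (hf : Integrable f) (hg : Integrable g)
    (v : Ed n) (hd : Differentiable ℝ g) (hg' : Integrable (dirDeriv v g)) :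
    pairing k f (dirDeriv v g) = pairing (dirDeriv v k) f g := by
  rw [← integral_integral_eq_pairing hk hf hg',
    ← integral_integral_eq_pairing (hk.dirDeriv v) hf hg]
  refine integral_congr_ae (ae_of_all _ fun x => ?_)
  simp only [mul_assoc]
  rw [integral_const_mul, integral_const_mul]
  congr 1
  have hkx : Differentiable ℝ fun y => k (x - y) := hk.differentiable.comp (by fun_prop)
  have hderiv : ∀ y, fderiv ℝ (fun y => k (x - y)) y v = -dirDeriv v k (x - y) := by
    intro y
    have h1 : HasFDerivAt (fun y : Ed n => x - y) (-ContinuousLinearMap.id ℝ (Ed n)) y :=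
      (hasFDerivAt_id y).const_sub x
    have h2 := ((hk.differentiable (x - y)).hasFDerivAt.comp y h1).fderiv
    simp only [Function.comp_def] at h2
    simp [h2, dirDeriv]
  have := integral_mul_fderiv_eq_neg_fderiv_mul_of_integrable (μ := volume)
    (f := fun y => k (x - y)) (g := g) (v := v)
    (by
      simp only [hderiv, neg_mul]
      exact (integrable_kernel_mul (hk.dirDeriv v) (by fun_prop) hg).neg)
    (integrable_kernel_mul hk (by fun_prop) hg') (integrable_kernel_mul hk (by fun_prop) hg)
    (fun y _ => hkx y) (fun y _ => hd y)
  simp only [hderiv, neg_mul, integral_neg, neg_neg] at this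
  exact this

lemma pairing_dirDeriv_left (hk : IsSmoothBdd k) (hf : Integrable f) (hg : Integrable g)
    (v : Ed n) (hd : Differentiable ℝ f) (hf' : Integrable (dirDeriv v f)) :
    pairing k (dirDeriv v f) g = -pairing (dirDeriv v k) f g := by
  unfold pairing
  rw [Measure.volume_eq_prod, integral_prod_symm _ (integrable_pairing hk hf' hg),
    integral_prod_symm _ (integrable_pairing (hk.dirDeriv v) hf hg), ← integral_neg]
  refine integral_congr_ae (ae_of_all _ fun y => ?_)
  simp only
  rw [integral_mul_const, integral_mul_const, ← neg_mul]
  congr 1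
  have hky : Differentiable ℝ fun x => k (x - y) := hk.differentiable.comp (by fun_prop)
  have hderiv : ∀ x, fderiv ℝ (fun x => k (x - y)) x v = dirDeriv v k (x - y) := by
    intro x
    rw [fderiv_comp_sub]
    rfl
  have := integral_mul_fderiv_eq_neg_fderiv_mul_of_integrable (μ := volume)
    (f := fun x => k (x - y)) (g := f) (v := v)
    (by simp only [hderiv]; exact integrable_kernel_mul (hk.dirDeriv v) (by fun_prop) hf)
    (integrable_kernel_mul hk (by fun_prop) hf')
    (integrable_kernel_mul hk (by fun_prop) hf) (fun y _ => hky y) (fun y _ => hd y)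
  simp only [hderiv] at this
  simp only [mul_comm (dirDeriv v f _), mul_comm (f _)]
  exact this

lemma hasDerivAt_pairing {F H : ℝ × Ed n → ℝ} (hk : IsSmoothBdd k) (hF : IsDecaying F)
    (hH : IsDecaying H) (t : ℝ) :
    HasDerivAt (fun s => pairing k (fun x => F (s, x)) (fun x => H (s, x)))
      (pairing k (fun x => dirDeriv (timeDir n) F (t, x)) (fun x => H (t, x))
        + pairing k (fun x => F (t, x)) (fun x => dirDeriv (timeDir n) H (t, x))) t := by
  have hF' := hF.dirDeriv (timeDir n)
  have hH' := hH.dirDeriv (timeDir n)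
  obtain ⟨K, hK0, hK⟩ := hk.bounded
  obtain ⟨A, hA0, hA⟩ := hF.exists_bound (t - 1) (t + 1)
  obtain ⟨A', hA'0, hA'⟩ := hF'.exists_bound (t - 1) (t + 1)
  obtain ⟨B, hB0, hB⟩ := hH.exists_bound (t - 1) (t + 1)
  obtain ⟨B', hB'0, hB'⟩ := hH'.exists_bound (t - 1) (t + 1)
  set w : Ed n → ℝ := fun x => (1 + ‖x‖) ^ (-((n + 1 : ℕ) : ℝ)) with hw
  have hw0 : ∀ x, 0 ≤ w x := fun x => by positivity
  have hi := fun s => integrable_pairing hk (hF.integrable s) (hH.integrable s)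
  have hi₁ := fun s => integrable_pairing hk (hF'.integrable s) (hH.integrable s)
  have hi₂ := fun s => integrable_pairing hk (hF.integrable s) (hH'.integrable s)
  have hwi : Integrable (fun z : Ed n × Ed n => (A' * K * B + A * K * B') * (w z.1 * w z.2)) :=
    ((integrable_weight n).mul_prod (integrable_weight n)).const_mul _
  have := (hasDerivAt_integral_of_dominated_loc_of_deriv_le (𝕜 := ℝ) (x₀ := t)
    (F := fun s (z : Ed n × Ed n) => F (s, z.1) * k (z.1 - z.2) * H (s, z.2))
    (F' := fun s (z : Ed n × Ed n) =>
      dirDeriv (timeDir n) F (s, z.1) * k (z.1 - z.2) * H (s, z.2)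
        + F (s, z.1) * k (z.1 - z.2) * dirDeriv (timeDir n) H (s, z.2))
    (s := Set.Icc (t - 1) (t + 1)) (Icc_mem_nhds (by linarith) (by linarith))
    (Eventually.of_forall fun s => (hi s).aestronglyMeasurable) (hi t)
    ((hi₁ t).add (hi₂ t)).aestronglyMeasurable
    (ae_of_all _ fun z s hs => ?_) hwi (ae_of_all _ fun z s _ => ?_)).2
  · rw [integral_add (hi₁ t) (hi₂ t)] at this
    exact this
  · have e : (A' * K * B + A * K * B') * (w z.1 * w z.2)
        = A' * w z.1 * K * (B * w z.2) + A * w z.1 * K * (B' * w z.2) := by ring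
    rw [e]
    refine (norm_add_le _ _).trans (add_le_add ?_ ?_)
    · simp only [norm_mul, Real.norm_eq_abs]
      have h1 := hw0 z.1
      have h2 := hA' s hs z.1
      have h3 := hB s hs z.2
      have h4 := hK (z.1 - z.2)
      gcongr
    · simp only [norm_mul, Real.norm_eq_abs]
      have h1 := hw0 z.1
      have h2 := hA s hs z.1
      have h3 := hB' s hs z.2
      have h4 := hK (z.1 - z.2)
      gcongr
  · exact ((hasDerivAt_slice_time hF.differentiable s z.1).mul_const _).mul
      (hasDerivAt_slice_time hH.differentiable s z.2)

end Pairing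

/-- `Φ` is integrable on the product space with integral `c`. -/
def HasDoubleIntegral {n : ℕ} (Φ : Ed n → Ed n → ℝ) (c : ℝ) : Prop :=
  Integrable (fun z : Ed n × Ed n => Φ z.1 z.2) ∧ ∫ z : Ed n × Ed n, Φ z.1 z.2 = c

namespace HasDoubleIntegral

variable {n : ℕ} {Φ Ψ : Ed n → Ed n → ℝ} {c d : ℝ}

lemma integral_integral (hΦ : HasDoubleIntegral Φ c) : ∫ x, ∫ y, Φ x y = c :=
  (MeasureTheory.integral_integral (f := Φ) hΦ.1).trans hΦ.2

lemma add (hΦ : HasDoubleIntegral Φ c) (hΨ : HasDoubleIntegral Ψ d) :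
    HasDoubleIntegral (fun x y => Φ x y + Ψ x y) (c + d) :=
  ⟨hΦ.1.add hΨ.1, by rw [integral_add hΦ.1 hΨ.1, hΦ.2, hΨ.2]⟩

lemma sub (hΦ : HasDoubleIntegral Φ c) (hΨ : HasDoubleIntegral Ψ d) :
    HasDoubleIntegral (fun x y => Φ x y - Ψ x y) (c - d) :=
  ⟨hΦ.1.sub hΨ.1, by rw [integral_sub hΦ.1 hΨ.1, hΦ.2, hΨ.2]⟩

lemma const_mul (hΦ : HasDoubleIntegral Φ c) (r : ℝ) :
    HasDoubleIntegral (fun x y => r * Φ x y) (r * c) :=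
  ⟨hΦ.1.const_mul r, by rw [integral_const_mul, hΦ.2]⟩

lemma sum {ι : Type*} {s : Finset ι} {Φ : ι → Ed n → Ed n → ℝ} {c : ι → ℝ}
    (hΦ : ∀ i, HasDoubleIntegral (Φ i) (c i)) :
    HasDoubleIntegral (fun x y => ∑ i ∈ s, Φ i x y) (∑ i ∈ s, c i) :=
  ⟨integrable_finsetSum s fun i _ => (hΦ i).1, by
    rw [integral_finsetSum s fun i _ => (hΦ i).1]
    exact Finset.sum_congr rfl fun i _ => (hΦ i).2⟩

lemma congr (hΦ : HasDoubleIntegral Φ c) (hΨ : ∀ x y, Ψ x y = Φ x y) :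
    HasDoubleIntegral Ψ c := by
  rwa [show Ψ = Φ from funext fun x => funext fun y => hΨ x y]

end HasDoubleIntegral

lemma hasDoubleIntegral_pairing {n : ℕ} {k f g : Ed n → ℝ} (hk : IsSmoothBdd k)
    (hf : Integrable f) (hg : Integrable g) :
    HasDoubleIntegral (fun x y => f x * k (x - y) * g y) (pairing k f g) :=
  ⟨integrable_pairing hk hf hg, rfl⟩

section Densities

variable {n : ℕ}

/-- The mass density of the wave function `a + ib`. -/
def massDensity (a b : ℝ × Ed n → ℝ) : ℝ × Ed n → ℝ := fun p => a p * a p + b p * b p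

/-- The mass current of the wave function `a + ib`. -/
def massCurrent (a b : ℝ × Ed n → ℝ) (k : Fin n) : ℝ × Ed n → ℝ := fun p =>
  a p * dirDeriv (spaceDir k) b p - b p * dirDeriv (spaceDir k) a p

/-- The stress tensor `Re (∂_k ū ∂_l u)` of the wave function `u = a + ib`. -/
def stressTensor (a b : ℝ × Ed n → ℝ) (k l : Fin n) : ℝ × Ed n → ℝ := fun p =>
  dirDeriv (spaceDir k) a p * dirDeriv (spaceDir l) a p
    + dirDeriv (spaceDir k) b p * dirDeriv (spaceDir l) b p

variable {a b : ℝ × Ed n → ℝ} {g : ℝ → ℝ}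

lemma isDecaying_massDensity (ha : IsDecaying a) (hb : IsDecaying b) :
    IsDecaying (massDensity a b) := (ha.mul ha).add (hb.mul hb)

lemma isDecaying_massCurrent (ha : IsDecaying a) (hb : IsDecaying b) (k : Fin n) :
    IsDecaying (massCurrent a b k) := (ha.mul (hb.dirDeriv _)).sub (hb.mul (ha.dirDeriv _))

lemma isDecaying_stressTensor (ha : IsDecaying a) (hb : IsDecaying b) (k l : Fin n) :
    IsDecaying (stressTensor a b k l) :=
  ((ha.dirDeriv _).mul (ha.dirDeriv _)).add ((hb.dirDeriv _).mul (hb.dirDeriv _))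

lemma dirDeriv_massDensity (ha : IsDecaying a) (hb : IsDecaying b) (v : ℝ × Ed n) :
    dirDeriv v (massDensity a b) = fun p => 2 * (a p * dirDeriv v a p + b p * dirDeriv v b p) := by
  unfold massDensity
  rw [dirDeriv_add (ha.mul ha).differentiable (hb.mul hb).differentiable,
    dirDeriv_mul ha.differentiable ha.differentiable,
    dirDeriv_mul hb.differentiable hb.differentiable]
  funext p
  ring

lemma dirDeriv_massCurrent (ha : IsDecaying a) (hb : IsDecaying b) (k : Fin n) (v : ℝ × Ed n) :
    dirDeriv v (massCurrent a b k) = fun p =>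
      dirDeriv v a p * dirDeriv (spaceDir k) b p + a p * dirDeriv v (dirDeriv (spaceDir k) b) p
        - (dirDeriv v b p * dirDeriv (spaceDir k) a p
          + b p * dirDeriv v (dirDeriv (spaceDir k) a) p) := by
  have ha' := ha.dirDeriv (spaceDir k)
  have hb' := hb.dirDeriv (spaceDir k)
  unfold massCurrent
  rw [dirDeriv_sub (ha.mul hb').differentiable (hb.mul ha').differentiable,
    dirDeriv_mul ha.differentiable hb'.differentiable,
    dirDeriv_mul hb.differentiable ha'.differentiable]

lemma dirDeriv_stressTensor (ha : IsDecaying a) (hb : IsDecaying b) (k l : Fin n)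
    (v : ℝ × Ed n) :
    dirDeriv v (stressTensor a b k l) = fun p =>
      dirDeriv v (dirDeriv (spaceDir k) a) p * dirDeriv (spaceDir l) a p
        + dirDeriv (spaceDir k) a p * dirDeriv v (dirDeriv (spaceDir l) a) p
        + (dirDeriv v (dirDeriv (spaceDir k) b) p * dirDeriv (spaceDir l) b p
          + dirDeriv (spaceDir k) b p * dirDeriv v (dirDeriv (spaceDir l) b) p) := by
  have hak := ha.dirDeriv (spaceDir k)
  have hbk := hb.dirDeriv (spaceDir k)
  have hal := ha.dirDeriv (spaceDir l)
  have hbl := hb.dirDeriv (spaceDir l)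
  unfold stressTensor
  rw [dirDeriv_add (hak.mul hal).differentiable (hbk.mul hbl).differentiable,
    dirDeriv_mul hak.differentiable hal.differentiable,
    dirDeriv_mul hbk.differentiable hbl.differentiable]

lemma dirDeriv_dirDeriv_dirDeriv_massDensity (ha : IsDecaying a) (hb : IsDecaying b)
    (v w : ℝ × Ed n) :
    dirDeriv v (dirDeriv w (dirDeriv w (massDensity a b))) = fun p =>
      2 * (2 * (dirDeriv v (dirDeriv w a) p * dirDeriv w a p)
        + (dirDeriv v a p * dirDeriv w (dirDeriv w a) p
          + a p * dirDeriv v (dirDeriv w (dirDeriv w a)) p)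
        + (2 * (dirDeriv v (dirDeriv w b) p * dirDeriv w b p)
        + (dirDeriv v b p * dirDeriv w (dirDeriv w b) p
          + b p * dirDeriv v (dirDeriv w (dirDeriv w b)) p))) := by
  have ha' := ha.dirDeriv w
  have hb' := hb.dirDeriv w
  have ha'' := ha'.dirDeriv w
  have hb'' := hb'.dirDeriv w
  rw [dirDeriv_massDensity ha hb,
    dirDeriv_const_mul ((ha.mul ha').add (hb.mul hb')).differentiable,
    dirDeriv_add (ha.mul ha').differentiable (hb.mul hb').differentiable,
    dirDeriv_mul ha.differentiable ha'.differentiable,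
    dirDeriv_mul hb.differentiable hb'.differentiable,
    dirDeriv_const_mul (((ha'.mul ha').add (ha.mul ha'')).add
      ((hb'.mul hb').add (hb.mul hb''))).differentiable,
    dirDeriv_add ((ha'.mul ha').add (ha.mul ha'')).differentiable
      ((hb'.mul hb').add (hb.mul hb'')).differentiable,
    dirDeriv_add (ha'.mul ha').differentiable (ha.mul ha'').differentiable,
    dirDeriv_add (hb'.mul hb').differentiable (hb.mul hb'').differentiable,
    dirDeriv_mul ha'.differentiable ha'.differentiable,
    dirDeriv_mul hb'.differentiable hb'.differentiable,
    dirDeriv_mul ha.differentiable ha''.differentiable,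
    dirDeriv_mul hb.differentiable hb''.differentiable]
  funext p
  ring

/-- The real and imaginary parts of the nonlinear Schrödinger equation for `a + ib`. -/
structure IsRealNLSSolution (g : ℝ → ℝ) (a b : ℝ × Ed n → ℝ) : Prop where
  decaying_re : IsDecaying a
  decaying_im : IsDecaying b
  time_re : dirDeriv (timeDir n) a = fun p =>
    -(1 / 2) * (∑ l, dirDeriv (spaceDir l) (dirDeriv (spaceDir l) b) p)
      + g (massDensity a b p) * b p
  time_im : dirDeriv (timeDir n) b = fun p =>
    1 / 2 * (∑ l, dirDeriv (spaceDir l) (dirDeriv (spaceDir l) a) p)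
      - g (massDensity a b p) * a p

namespace IsRealNLSSolution

lemma continuity_equation (hab : IsRealNLSSolution g a b) :
    dirDeriv (timeDir n) (massDensity a b) = fun p =>
      -1 * ∑ l, dirDeriv (spaceDir l) (massCurrent a b l) p := by
  have ha := hab.decaying_re
  have hb := hab.decaying_im
  rw [dirDeriv_massDensity ha hb, hab.time_re, hab.time_im]
  funext p
  have : ∑ l, dirDeriv (spaceDir l) (massCurrent a b l) p
      = a p * ∑ l, dirDeriv (spaceDir l) (dirDeriv (spaceDir l) b) p
        - b p * ∑ l, dirDeriv (spaceDir l) (dirDeriv (spaceDir l) a) p := by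
    rw [Finset.mul_sum, Finset.mul_sum, ← Finset.sum_sub_distrib]
    refine Finset.sum_congr rfl fun l _ => ?_
    rw [dirDeriv_massCurrent ha hb]
    ring
  rw [this]
  ring

lemma momentum_equation (hg : ContDiff ℝ (⊤ : ℕ∞) g) (hab : IsRealNLSSolution g a b)
    (k : Fin n) :
    dirDeriv (timeDir n) (massCurrent a b k) = fun p =>
      (-1 * ∑ l, dirDeriv (spaceDir l) (stressTensor a b k l) p
        + 1 / 4 * ∑ l, dirDeriv (spaceDir k)
          (dirDeriv (spaceDir l) (dirDeriv (spaceDir l) (massDensity a b))) p)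
        + -1 * (massDensity a b p * deriv g (massDensity a b p)
            * dirDeriv (spaceDir k) (massDensity a b) p) := by
  have ha := hab.decaying_re
  have hb := hab.decaying_im
  have hρ := (isDecaying_massDensity ha hb).differentiable
  have hgd : Differentiable ℝ g := hg.differentiable (by simp)
  have hgρ : Differentiable ℝ fun p => g (massDensity a b p) := hgd.comp hρ
  have hgρ' : dirDeriv (spaceDir k) (fun p => g (massDensity a b p)) = fun p =>
      deriv g (massDensity a b p) * dirDeriv (spaceDir k) (massDensity a b) p :=
    dirDeriv_comp (fun r => (hgd r).hasDerivAt) hρ _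
  have hga : Differentiable ℝ fun p => g (massDensity a b p) * a p := hgρ.mul ha.differentiable
  have hgb : Differentiable ℝ fun p => g (massDensity a b p) * b p := hgρ.mul hb.differentiable
  have hlap : ∀ {c : ℝ × Ed n → ℝ}, IsDecaying c →
      IsDecaying fun p => ∑ l, dirDeriv (spaceDir l) (dirDeriv (spaceDir l) c) p :=
    fun hc => IsDecaying.sum fun l => (hc.dirDeriv _).dirDeriv _
  have hka : dirDeriv (timeDir n) (dirDeriv (spaceDir k) a) = fun p =>
      -(1 / 2) * (∑ l, dirDeriv (spaceDir k) (dirDeriv (spaceDir l) (dirDeriv (spaceDir l) b)) p)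
        + (deriv g (massDensity a b p) * dirDeriv (spaceDir k) (massDensity a b) p * b p
          + g (massDensity a b p) * dirDeriv (spaceDir k) b p) := by
    rw [dirDeriv_comm ha.1, hab.time_re,
      dirDeriv_add ((hlap hb).const_mul _).differentiable hgb,
      dirDeriv_const_mul (hlap hb).differentiable,
      dirDeriv_sum fun l => ((hb.dirDeriv _).dirDeriv _).differentiable,
      dirDeriv_mul hgρ hb.differentiable, hgρ']
  have hkb : dirDeriv (timeDir n) (dirDeriv (spaceDir k) b) = fun p =>
      1 / 2 * (∑ l, dirDeriv (spaceDir k) (dirDeriv (spaceDir l) (dirDeriv (spaceDir l) a)) p)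
        - (deriv g (massDensity a b p) * dirDeriv (spaceDir k) (massDensity a b) p * a p
          + g (massDensity a b p) * dirDeriv (spaceDir k) a p) := by
    rw [dirDeriv_comm hb.1, hab.time_im,
      dirDeriv_sub ((hlap ha).const_mul _).differentiable hga,
      dirDeriv_const_mul (hlap ha).differentiable,
      dirDeriv_sum fun l => ((ha.dirDeriv _).dirDeriv _).differentiable,
      dirDeriv_mul hgρ ha.differentiable, hgρ']
  rw [dirDeriv_massCurrent ha hb, hka, hkb, hab.time_re, hab.time_im]
  funext p
  have hkin : -1 * ∑ l, dirDeriv (spaceDir l) (stressTensor a b k l) p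
        + 1 / 4 * ∑ l, dirDeriv (spaceDir k)
          (dirDeriv (spaceDir l) (dirDeriv (spaceDir l) (massDensity a b))) p
      = 1 / 2 * (a p * ∑ l, dirDeriv (spaceDir k)
            (dirDeriv (spaceDir l) (dirDeriv (spaceDir l) a)) p
          + b p * ∑ l, dirDeriv (spaceDir k) (dirDeriv (spaceDir l) (dirDeriv (spaceDir l) b)) p
          - dirDeriv (spaceDir k) a p * ∑ l, dirDeriv (spaceDir l) (dirDeriv (spaceDir l) a) p
          - dirDeriv (spaceDir k) b p
            * ∑ l, dirDeriv (spaceDir l) (dirDeriv (spaceDir l) b) p) := by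
    simp only [Finset.mul_sum, ← Finset.sum_add_distrib, ← Finset.sum_sub_distrib]
    refine Finset.sum_congr rfl fun l _ => ?_
    rw [dirDeriv_stressTensor ha hb, dirDeriv_dirDeriv_dirDeriv_massDensity ha hb,
      dirDeriv_comm ha.1 (spaceDir k) (spaceDir l), dirDeriv_comm hb.1 (spaceDir k) (spaceDir l)]
    ring
  rw [hkin]
  simp only [massDensity]
  ring

end IsRealNLSSolution

end Densities

section SlicePairing

variable {n : ℕ} {k f g : Ed n → ℝ} {H : ℝ × Ed n → ℝ}

lemma dirDeriv_slice (hH : IsDecaying H) (l : Fin n) (t : ℝ) :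
    dirDeriv (EuclideanSpace.single l 1) (fun x => H (t, x))
      = fun x => dirDeriv (spaceDir l) H (t, x) :=
  funext fun x => fderiv_slice_space hH.differentiable l t x

lemma pairing_slice_right (hk : IsSmoothBdd k) (hf : Integrable f) (hH : IsDecaying H)
    (l : Fin n) (t : ℝ) :
    pairing k f (fun x => dirDeriv (spaceDir l) H (t, x))
      = pairing (dirDeriv (EuclideanSpace.single l 1) k) f (fun x => H (t, x)) := by
  rw [← pairing_dirDeriv_right hk hf (hH.integrable t) _ (hH.slice_differentiable t)
    (by rw [dirDeriv_slice hH]; exact (hH.dirDeriv _).integrable t), dirDeriv_slice hH]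

lemma pairing_slice_left (hk : IsSmoothBdd k) (hg : Integrable g) (hH : IsDecaying H)
    (l : Fin n) (t : ℝ) :
    pairing k (fun x => dirDeriv (spaceDir l) H (t, x)) g
      = -pairing (dirDeriv (EuclideanSpace.single l 1) k) (fun x => H (t, x)) g := by
  rw [← pairing_dirDeriv_left hk (hH.integrable t) hg _ (hH.slice_differentiable t)
    (by rw [dirDeriv_slice hH]; exact (hH.dirDeriv _).integrable t), dirDeriv_slice hH]

end SlicePairing

section Pressure

variable {n : ℕ} {g G : ℝ → ℝ} {ρ : ℝ × Ed n → ℝ}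

lemma exists_bound_comp {φ : ℝ → ℝ} (hφ : Continuous φ) (hρ : IsDecaying ρ) (t : ℝ) :
    ∃ C : ℝ, ∀ x, ∀ r, |r| ≤ |ρ (t, x)| → |φ r| ≤ C := by
  obtain ⟨R, hR⟩ := hρ.bounded t
  obtain ⟨C, hC⟩ := (isCompact_Icc (a := -R) (b := R)).exists_bound_of_continuousOn
    hφ.continuousOn
  exact ⟨C, fun x r hr => hC r (abs_le.1 (hr.trans (hR x)))⟩

lemma integrable_mul_comp {φ : ℝ → ℝ} (hφ : Continuous φ) (hρ : IsDecaying ρ) {f : Ed n → ℝ}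
    (hf : Integrable f) (t : ℝ) : Integrable fun x => f x * φ (ρ (t, x)) := by
  obtain ⟨C, hC⟩ := exists_bound_comp hφ hρ t
  have hc : Continuous fun x => φ (ρ (t, x)) := hφ.comp (hρ.1.continuous.comp (by fun_prop))
  exact hf.mul_bdd (c := C) hc.aestronglyMeasurable (ae_of_all _ fun x => hC x _ le_rfl)

lemma hasDerivAt_primitive (hg : Continuous g) (hG : ∀ r : ℝ, G r = ∫ s in (0:ℝ)..r, g s) (r : ℝ) :
    HasDerivAt G (g r) r := by
  rw [show G = fun r => ∫ s in (0:ℝ)..r, g s from funext hG]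
  exact intervalIntegral.integral_hasDerivAt_right (hg.intervalIntegrable _ _)
    hg.aestronglyMeasurable.stronglyMeasurableAtFilter hg.continuousAt

lemma integrable_primitive_comp (hg : Continuous g) (hG : ∀ r : ℝ, G r = ∫ s in (0:ℝ)..r, g s)
    (hρ : IsDecaying ρ) (t : ℝ) : Integrable fun x => G (ρ (t, x)) := by
  obtain ⟨C, hC⟩ := exists_bound_comp hg hρ t
  have hGc : Continuous G :=
    continuous_iff_continuousAt.2 fun r => (hasDerivAt_primitive hg hG r).continuousAt
  have hc : Continuous fun x => G (ρ (t, x)) := hGc.comp (hρ.1.continuous.comp (by fun_prop))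
  refine ((hρ.integrable t).norm.const_mul C).mono' hc.aestronglyMeasurable
    (ae_of_all _ fun x => ?_)
  rw [hG]
  have := intervalIntegral.norm_integral_le_of_norm_le_const (a := 0) (b := ρ (t, x)) (f := g)
    (C := C) fun s hs => hC x s ?_
  · simpa using this
  · rcases Set.mem_uIoc.1 hs with h | h
    · rw [abs_of_pos h.1]; exact h.2.trans (le_abs_self _)
    · rw [abs_of_nonpos h.2]; exact (neg_le_neg h.1.le).trans (neg_le_abs _)

lemma integrable_pressure (hg : Continuous g) (hG : ∀ r : ℝ, G r = ∫ s in (0:ℝ)..r, g s)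
    (hρ : IsDecaying ρ) (t : ℝ) :
    Integrable fun x => ρ (t, x) * g (ρ (t, x)) - G (ρ (t, x)) :=
  (integrable_mul_comp hg hρ (hρ.integrable t) t).sub (integrable_primitive_comp hg hG hρ t)

lemma integrable_pressure_gradient (hg : ContDiff ℝ (⊤ : ℕ∞) g) (hρ : IsDecaying ρ) (l : Fin n)
    (t : ℝ) :
    Integrable fun x => ρ (t, x) * deriv g (ρ (t, x)) * dirDeriv (spaceDir l) ρ (t, x) := by
  have := integrable_mul_comp (hg.continuous_deriv (by exact_mod_cast le_top)) hρ
    ((hρ.mul (hρ.dirDeriv (spaceDir l))).integrable t) t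
  exact this.congr (ae_of_all _ fun x => by ring)

lemma pairing_pressure_gradient {k f : Ed n → ℝ} (hk : IsSmoothBdd k) (hf : Integrable f)
    (hg : ContDiff ℝ (⊤ : ℕ∞) g) (hG : ∀ r : ℝ, G r = ∫ s in (0:ℝ)..r, g s)
    (hρ : IsDecaying ρ) (l : Fin n) (t : ℝ) :
    pairing k f
        (fun x => ρ (t, x) * deriv g (ρ (t, x)) * dirDeriv (spaceDir l) ρ (t, x))
      = pairing (dirDeriv (EuclideanSpace.single l 1) k) f
        (fun x => ρ (t, x) * g (ρ (t, x)) - G (ρ (t, x))) := by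
  have hgd : Differentiable ℝ g := hg.differentiable (by simp)
  have hGd := hasDerivAt_primitive hg.continuous hG
  have hρd := hρ.slice_differentiable t
  have hφ : ∀ r, HasDerivAt (fun r => r * g r - G r) (r * deriv g r) r := by
    intro r
    have := ((hasDerivAt_id r).mul (hgd r).hasDerivAt).sub (hGd r)
    simp only [id, one_mul, add_sub_cancel_left] at this
    exact this
  have key : dirDeriv (EuclideanSpace.single l 1)
      (fun x => ρ (t, x) * g (ρ (t, x)) - G (ρ (t, x)))
      = fun x => ρ (t, x) * deriv g (ρ (t, x)) * dirDeriv (spaceDir l) ρ (t, x) := by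
    rw [dirDeriv_comp hφ hρd, dirDeriv_slice hρ]
  have hd : Differentiable ℝ fun x => ρ (t, x) * g (ρ (t, x)) - G (ρ (t, x)) :=
    Differentiable.comp (g := fun r => r * g r - G r) (fun r => (hφ r).differentiableAt) hρd
  rw [← key]
  refine pairing_dirDeriv_right hk hf (integrable_pressure hg.continuous hG hρ t) _ hd ?_
  rw [key]
  exact integrable_pressure_gradient hg hρ l t

end Pressure

section Kernel

variable {n : ℕ} {h : Ed n → ℝ}

lemma dirDeriv_comp_neg (hd : Differentiable ℝ h) (v x : Ed n) :
    dirDeriv v (fun y => h (-y)) x = -dirDeriv v h (-x) := by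
  have := ((hd (-x)).hasFDerivAt.comp x (hasFDerivAt_id x).fun_neg).fderiv
  simp only [Function.comp_def] at this
  simp [dirDeriv, this]

lemma dirDeriv_neg_arg_of_even (hd : Differentiable ℝ h) (heven : ∀ x, h (-x) = h x)
    (v x : Ed n) : dirDeriv v h (-x) = -dirDeriv v h x := by
  have := dirDeriv_comp_neg hd v x
  rw [show (fun y => h (-y)) = h from funext heven] at this
  linarith

lemma dirDeriv_neg_arg_of_odd (hd : Differentiable ℝ h) (hodd : ∀ x, h (-x) = -h x)
    (v x : Ed n) : dirDeriv v h (-x) = dirDeriv v h x := by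
  have := dirDeriv_comp_neg hd v x
  rw [show (fun y => h (-y)) = fun y => -1 * h y from funext fun y => by rw [hodd]; ring,
    dirDeriv_const_mul hd] at this
  linarith

lemma hess_eq (k l : Fin n) :
    hess h k l = dirDeriv (EuclideanSpace.single k 1) (dirDeriv (EuclideanSpace.single l 1) h) :=
  rfl

lemma hess_comm (hs : ContDiff ℝ (⊤ : ℕ∞) h) (k l : Fin n) : hess h k l = hess h l k :=
  dirDeriv_comm hs _ _

lemma hess_neg (hs : ContDiff ℝ (⊤ : ℕ∞) h) (heven : ∀ x, h (-x) = h x) (k l : Fin n)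
    (x : Ed n) : hess h k l (-x) = hess h k l x :=
  dirDeriv_neg_arg_of_odd ((hs.dirDeriv _).differentiable (by simp))
    (fun y => dirDeriv_neg_arg_of_even (hs.differentiable (by simp)) heven _ y) _ x

end Kernel

section Virial

variable {n : ℕ} {a b : ℝ × Ed n → ℝ} {g G : ℝ → ℝ} {h : Ed n → ℝ}

lemma pairing_hess_gradient (hs : ContDiff ℝ (⊤ : ℕ∞) h)
    (hbdd : ∀ i : ℕ, 1 ≤ i → ∃ C : ℝ, ∀ x, ‖iteratedFDeriv ℝ i h x‖ ≤ C)
    {ρ : ℝ × Ed n → ℝ} (hρ : IsDecaying ρ) (k l : Fin n) (t : ℝ) :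
    pairing (hess h k l) (fun x => dirDeriv (spaceDir l) ρ (t, x))
        (fun x => dirDeriv (spaceDir k) ρ (t, x))
      = pairing (hess h l l) (fun x => dirDeriv (spaceDir k) ρ (t, x))
        (fun x => dirDeriv (spaceDir k) ρ (t, x)) := by
  have hk : ∀ l : Fin n, IsSmoothBdd (dirDeriv (EuclideanSpace.single l 1) h) :=
    fun l => isSmoothBdd_dirDeriv_of_bounded hs hbdd _
  have hkk : ∀ k l : Fin n, IsSmoothBdd (hess h k l) := fun k l => (hk l).dirDeriv _
  have hi := (hρ.dirDeriv (spaceDir k)).integrable t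
  rw [pairing_slice_left (hkk k l) hi hρ, pairing_slice_left (hkk l l) hi hρ, hess_eq, hess_eq,
    dirDeriv_comm (hk l).1]

lemma IsRealNLSSolution.hasDerivAt_pairing (hg : ContDiff ℝ (⊤ : ℕ∞) g)
    (hG : ∀ r : ℝ, G r = ∫ s in (0:ℝ)..r, g s) (hs : ContDiff ℝ (⊤ : ℕ∞) h)
    (hbdd : ∀ i : ℕ, 1 ≤ i → ∃ C : ℝ, ∀ x, ‖iteratedFDeriv ℝ i h x‖ ≤ C)
    (hab : IsRealNLSSolution g a b) (k : Fin n) (t : ℝ) :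
    HasDerivAt (fun s => pairing (pdR k h) (fun x => massDensity a b (s, x))
        (fun x => massCurrent a b k (s, x)))
      (∑ l, pairing (hess h k l) (fun x => massCurrent a b l (t, x))
          (fun x => massCurrent a b k (t, x))
        - ∑ l, pairing (hess h k l) (fun x => massDensity a b (t, x))
          (fun x => stressTensor a b k l (t, x))
        - 1 / 4 * ∑ l, pairing (hess h k k)
          (fun x => dirDeriv (spaceDir l) (massDensity a b) (t, x))
          (fun x => dirDeriv (spaceDir l) (massDensity a b) (t, x))
        - pairing (hess h k k) (fun x => massDensity a b (t, x))
          (fun x => massDensity a b (t, x) * g (massDensity a b (t, x))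
            - G (massDensity a b (t, x)))) t := by
  have ha := hab.decaying_re
  have hb := hab.decaying_im
  have hρ := isDecaying_massDensity ha hb
  have hj := fun l => isDecaying_massCurrent ha hb (n := n) l
  have hσ := fun k l => isDecaying_stressTensor ha hb (n := n) k l
  have hk : ∀ l : Fin n, IsSmoothBdd (pdR l h) :=
    fun l => isSmoothBdd_dirDeriv_of_bounded hs hbdd _
  have hkk : ∀ k l : Fin n, IsSmoothBdd (hess h k l) := fun k l => (hk l).dirDeriv _
  have hcomm : ∀ l, dirDeriv (EuclideanSpace.single l 1) (pdR k h) = hess h k l :=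
    fun l => hess_comm hs l k
  have hρρ : ∀ l, IsDecaying (dirDeriv (spaceDir l) (dirDeriv (spaceDir l) (massDensity a b))) :=
    fun l => (hρ.dirDeriv _).dirDeriv _
  have hρi := hρ.integrable t
  have hji := fun l => (hj l).integrable t
  convert _root_.hasDerivAt_pairing (hk k) hρ (hj k) t using 1
  rw [hab.continuity_equation, hab.momentum_equation hg, pairing_const_mul_left,
    pairing_sum_left (hk k) (fun l => ((hj l).dirDeriv _).integrable t) (hji k),
    pairing_add_right (hk k) hρi
      ((((IsDecaying.sum fun l => (hσ k l).dirDeriv (spaceDir l)).const_mul _).add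
        ((IsDecaying.sum fun l => (hρρ l).dirDeriv (spaceDir k)).const_mul _)).integrable t)
      ((integrable_pressure_gradient hg hρ k t).const_mul _),
    pairing_add_right (hk k) hρi
      (((IsDecaying.sum fun l => (hσ k l).dirDeriv (spaceDir l)).const_mul _).integrable t)
      (((IsDecaying.sum fun l => (hρρ l).dirDeriv (spaceDir k)).const_mul _).integrable t),
    pairing_const_mul_right, pairing_const_mul_right, pairing_const_mul_right,
    pairing_sum_right (hk k) hρi (fun l => ((hσ k l).dirDeriv _).integrable t),
    pairing_sum_right (hk k) hρi (fun l => ((hρρ l).dirDeriv _).integrable t),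
    pairing_pressure_gradient (hk k) hρi hg hG hρ]
  simp only [pairing_slice_left (hk k) (hji k) (hj _), pairing_slice_right (hk k) hρi (hσ _ _),
    pairing_slice_right (hk k) hρi (hρρ _), hcomm]
  have hvir : ∀ l, pairing (hess h k k) (fun x => massDensity a b (t, x))
        (fun x => dirDeriv (spaceDir l) (dirDeriv (spaceDir l) (massDensity a b)) (t, x))
      = -pairing (hess h k k) (fun x => dirDeriv (spaceDir l) (massDensity a b) (t, x))
        (fun x => dirDeriv (spaceDir l) (massDensity a b) (t, x)) := by
    intro l
    rw [pairing_slice_right (hkk k k) hρi (hρ.dirDeriv _),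
      pairing_slice_left (hkk k k) ((hρ.dirDeriv _).integrable t) hρ, neg_neg]
  simp only [hvir, Finset.sum_neg_distrib]
  ring

end Virial

section ComplexToReal

variable {n : ℕ} {U : ℝ × Ed n → ℂ}

lemma dirDeriv_re (hU : Differentiable ℝ U) (v : ℝ × Ed n) :
    (fun p => (fderiv ℝ U p v).re) = dirDeriv v (fun p => (U p).re) := by
  funext p
  have := (reCLM.hasFDerivAt.comp p (hU p).hasFDerivAt).fderiv
  simp only [Function.comp_def, reCLM_apply] at this
  simp [dirDeriv, this]

lemma dirDeriv_im (hU : Differentiable ℝ U) (v : ℝ × Ed n) :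
    (fun p => (fderiv ℝ U p v).im) = dirDeriv v (fun p => (U p).im) := by
  funext p
  have := (imCLM.hasFDerivAt.comp p (hU p).hasFDerivAt).fderiv
  simp only [Function.comp_def, imCLM_apply] at this
  simp [dirDeriv, this]

lemma pd_slice (hU : Differentiable ℝ U) (k : Fin n) (t : ℝ) (x : Ed n) :
    pd k (fun y => U (t, y)) x
      = ⟨dirDeriv (spaceDir k) (fun p => (U p).re) (t, x),
        dirDeriv (spaceDir k) (fun p => (U p).im) (t, x)⟩ := by
  rw [pd, fderiv_slice_space hU, ← dirDeriv_re hU, ← dirDeriv_im hU]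

lemma pd_pd_slice (hU : ContDiff ℝ (⊤ : ℕ∞) U) (k : Fin n) (t : ℝ) (x : Ed n) :
    pd k (fun y => pd k (fun y => U (t, y)) y) x
      = ⟨dirDeriv (spaceDir k) (dirDeriv (spaceDir k) (fun p => (U p).re)) (t, x),
        dirDeriv (spaceDir k) (dirDeriv (spaceDir k) (fun p => (U p).im)) (t, x)⟩ := by
  have hd : Differentiable ℝ U := hU.differentiable (by simp)
  have hd' : Differentiable ℝ fun p => fderiv ℝ U p (spaceDir k) :=
    ((hU.fderiv_right (m := (⊤ : ℕ∞)) (by simp)).clm_apply contDiff_const).differentiable (by simp)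
  have : (fun y => pd k (fun y => U (t, y)) y) = fun y => fderiv ℝ U (t, y) (spaceDir k) :=
    funext fun y => fderiv_slice_space hd k t y
  rw [this, pd_slice hd', dirDeriv_re hd, dirDeriv_im hd]

lemma lapC_slice (hU : ContDiff ℝ (⊤ : ℕ∞) U) (t : ℝ) (x : Ed n) :
    lapC (fun y => U (t, y)) x
      = ⟨∑ k, dirDeriv (spaceDir k) (dirDeriv (spaceDir k) (fun p => (U p).re)) (t, x),
        ∑ k, dirDeriv (spaceDir k) (dirDeriv (spaceDir k) (fun p => (U p).im)) (t, x)⟩ := by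
  simp only [lapC, pd_pd_slice hU]
  apply Complex.ext <;> simp

lemma isDecaying_clm_comp {u : ℝ → Ed n → ℂ}
    (hc : ContDiff ℝ (⊤ : ℕ∞) (fun p : ℝ × Ed n => u p.1 p.2)) (hu : SchwartzDecay u)
    (L : ℂ →L[ℝ] ℝ) : IsDecaying fun p : ℝ × Ed n => L (u p.1 p.2) := by
  refine ⟨L.contDiff.comp hc, fun N m a b => ?_⟩
  obtain ⟨C, hC⟩ := hu N m a b
  refine ⟨‖L‖ * C, fun t ht x => ?_⟩
  calc _ ≤ (1 + ‖x‖) ^ m *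
        (‖L‖ * ‖iteratedFDeriv ℝ N (fun p : ℝ × Ed n => u p.1 p.2) (t, x)‖) := by
        gcongr
        exact L.norm_iteratedFDeriv_comp_left hc.contDiffAt (by exact_mod_cast le_top)
    _ = ‖L‖ * ((1 + ‖x‖) ^ m *
        ‖iteratedFDeriv ℝ N (fun p : ℝ × Ed n => u p.1 p.2) (t, x)‖) := by ring
    _ ≤ _ := by gcongr; exact hC t ht x

lemma dens_eq_massDensity (u : ℝ → Ed n → ℂ) (t : ℝ) (x : Ed n) :
    dens u t x = massDensity (fun p => (u p.1 p.2).re) (fun p => (u p.1 p.2).im) (t, x) := by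
  rw [dens, Complex.sq_norm, Complex.normSq_apply, massDensity]

lemma IsNLSSolution.isRealNLSSolution {g : ℝ → ℝ} {u : ℝ → Ed n → ℂ} (hu : IsNLSSolution g u) :
    IsRealNLSSolution g (fun p : ℝ × Ed n => (u p.1 p.2).re)
      (fun p : ℝ × Ed n => (u p.1 p.2).im) := by
  obtain ⟨hc, hdec, heq⟩ := hu
  have hd : Differentiable ℝ (fun p : ℝ × Ed n => u p.1 p.2) := hc.differentiable (by simp)
  have key : ∀ p : ℝ × Ed n, Complex.I *
      fderiv ℝ (fun p : ℝ × Ed n => u p.1 p.2) p (timeDir n) =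
      -(1/2) * lapC (fun y => (fun p : ℝ × Ed n => u p.1 p.2) (p.1, y)) p.2
        + ((g (dens u p.1 p.2) : ℝ) : ℂ) * u p.1 p.2 := by
    intro p
    rw [← (hasDerivAt_slice_time hd p.1 p.2).deriv]
    exact heq p.1 p.2
  refine ⟨isDecaying_clm_comp hc hdec reCLM, isDecaying_clm_comp hc hdec imCLM, ?_, ?_⟩
  · rw [← dirDeriv_re hd]
    funext p
    have := congrArg Complex.im (key p)
    rw [lapC_slice hc, dens_eq_massDensity] at this
    simpa using this
  · rw [← dirDeriv_im hd]
    funext p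
    have := congrArg Complex.re (key p)
    rw [lapC_slice hc, dens_eq_massDensity] at this
    simp at this
    linarith

lemma curr_eq_massCurrent {u : ℝ → Ed n → ℂ}
    (hd : Differentiable ℝ (fun p : ℝ × Ed n => u p.1 p.2)) (k : Fin n) (t : ℝ) (x : Ed n) :
    curr u k t x
      = massCurrent (fun p => (u p.1 p.2).re) (fun p => (u p.1 p.2).im) k (t, x) := by
  have := pd_slice hd k t x
  simp only at this
  rw [curr, this]
  simp [massCurrent]
  ring

lemma re_conj_wVec_mul_wVec {u : ℝ → Ed n → ℂ} {a b : ℝ × Ed n → ℝ}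
    (hd : Differentiable ℝ (fun p : ℝ × Ed n => u p.1 p.2))
    (ha : IsDecaying a) (hb : IsDecaying b) (hau : a = fun p => (u p.1 p.2).re)
    (hbu : b = fun p => (u p.1 p.2).im) (k l : Fin n) (t : ℝ) (x y : Ed n) :
    ((starRingEnd ℂ) (wVec u t x y k) * wVec u t x y l).re
      = massDensity a b (t, x) * stressTensor a b k l (t, y)
        + stressTensor a b k l (t, x) * massDensity a b (t, y)
        - (1 / 4 * (dirDeriv (spaceDir l) (massDensity a b) (t, x)
              * dirDeriv (spaceDir k) (massDensity a b) (t, y))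
            + massCurrent a b l (t, x) * massCurrent a b k (t, y))
        - (1 / 4 * (dirDeriv (spaceDir l) (massDensity a b) (t, y)
              * dirDeriv (spaceDir k) (massDensity a b) (t, x))
            + massCurrent a b l (t, y) * massCurrent a b k (t, x)) := by
  have hpd : ∀ (m : Fin n) (z : Ed n), pd m (u t) z
      = ⟨dirDeriv (spaceDir m) a (t, z), dirDeriv (spaceDir m) b (t, z)⟩ := by
    intro m z
    rw [hau, hbu]
    exact pd_slice hd m t z
  have hu : ∀ z, u t z = ⟨a (t, z), b (t, z)⟩ := by
    intro z
    rw [hau, hbu]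
  rw [dirDeriv_massDensity ha hb, dirDeriv_massDensity ha hb]
  simp only [wVec, hpd, hu, massDensity, massCurrent, stressTensor, map_sub, map_mul,
    Complex.mul_re, Complex.mul_im, Complex.sub_re, Complex.sub_im, Complex.conj_re,
    Complex.conj_im]
  ring

end ComplexToReal

section Morawetz

variable {n : ℕ} {g G : ℝ → ℝ} {h : Ed n → ℝ} {u : ℝ → Ed n → ℂ}

lemma morawetzM_eq (hs : ContDiff ℝ (⊤ : ℕ∞) h)
    (hbdd : ∀ i : ℕ, 1 ≤ i → ∃ C : ℝ, ∀ x, ‖iteratedFDeriv ℝ i h x‖ ≤ C)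
    (hu : IsNLSSolution g u) (t : ℝ) :
    morawetzM h u t = -∑ k, pairing (pdR k h)
      (fun x => massDensity (fun p => (u p.1 p.2).re) (fun p => (u p.1 p.2).im) (t, x))
      (fun x => massCurrent (fun p => (u p.1 p.2).re) (fun p => (u p.1 p.2).im) k (t, x)) := by
  obtain ⟨ha, hb, -, -⟩ := hu.isRealNLSSolution
  have hd : Differentiable ℝ (fun p : ℝ × Ed n => u p.1 p.2) := hu.1.differentiable (by simp)
  have hk : ∀ l : Fin n, IsSmoothBdd (pdR l h) :=
    fun l => isSmoothBdd_dirDeriv_of_bounded hs hbdd _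
  rw [morawetzM, neg_inj]
  refine ((HasDoubleIntegral.sum fun k => hasDoubleIntegral_pairing (hk k)
    ((isDecaying_massDensity ha hb).integrable t)
    ((isDecaying_massCurrent ha hb k).integrable t)).congr fun x y => ?_).integral_integral
  simp only [dens_eq_massDensity, curr_eq_massCurrent hd, Finset.mul_sum, mul_assoc]

lemma morawetzR_eq (hs : ContDiff ℝ (⊤ : ℕ∞) h) (heven : ∀ x, h (-x) = h x)
    (hbdd : ∀ i : ℕ, 1 ≤ i → ∃ C : ℝ, ∀ x, ‖iteratedFDeriv ℝ i h x‖ ≤ C)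
    (hu : IsNLSSolution g u) {a b : ℝ × Ed n → ℝ} (hau : a = fun p => (u p.1 p.2).re)
    (hbu : b = fun p => (u p.1 p.2).im) (t : ℝ) :
    morawetzR h u t = ∑ k, ∑ l,
      (pairing (hess h k l) (fun x => massDensity a b (t, x))
          (fun x => stressTensor a b k l (t, x))
        - (1 / 4 * pairing (hess h k l)
            (fun x => dirDeriv (spaceDir l) (massDensity a b) (t, x))
            (fun x => dirDeriv (spaceDir k) (massDensity a b) (t, x))
          + pairing (hess h k l) (fun x => massCurrent a b l (t, x))
            (fun x => massCurrent a b k (t, x)))) := by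
  have hab := hu.isRealNLSSolution
  rw [← hau, ← hbu] at hab
  obtain ⟨ha, hb, -, -⟩ := hab
  have hd : Differentiable ℝ (fun p : ℝ × Ed n => u p.1 p.2) := hu.1.differentiable (by simp)
  have hkk : ∀ k l : Fin n, IsSmoothBdd (hess h k l) :=
    fun k l => (isSmoothBdd_dirDeriv_of_bounded hs hbdd _).dirDeriv _
  have hρ := isDecaying_massDensity ha hb
  have hρi := hρ.integrable t
  have hρ' := fun k : Fin n => (hρ.dirDeriv (spaceDir k)).integrable t
  have hj := fun k : Fin n => (isDecaying_massCurrent ha hb k).integrable t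
  have hσ := fun k l : Fin n => (isDecaying_stressTensor ha hb k l).integrable t
  have hint := HasDoubleIntegral.sum (s := Finset.univ) fun k =>
    HasDoubleIntegral.sum (s := Finset.univ) fun l =>
      (((hasDoubleIntegral_pairing (hkk k l) hρi (hσ k l)).add
        (hasDoubleIntegral_pairing (hkk k l) (hσ k l) hρi)).sub
        (((hasDoubleIntegral_pairing (hkk k l) (hρ' l) (hρ' k)).const_mul (1 / 4)).add
          (hasDoubleIntegral_pairing (hkk k l) (hj l) (hj k)))).sub
        (((hasDoubleIntegral_pairing (hkk k l) (hρ' k) (hρ' l)).const_mul (1 / 4)).add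
          (hasDoubleIntegral_pairing (hkk k l) (hj k) (hj l)))
  rw [morawetzR, (hint.congr fun x y => ?_).integral_integral]
  · rw [Finset.mul_sum]
    refine Finset.sum_congr rfl fun k _ => ?_
    rw [Finset.mul_sum]
    refine Finset.sum_congr rfl fun l _ => ?_
    have hsym := hess_neg hs heven k l
    rw [pairing_symm (f := fun x => stressTensor a b k l (t, x)) hsym,
      pairing_symm (f := fun x => dirDeriv (spaceDir k) (massDensity a b) (t, x)) hsym,
      pairing_symm (f := fun x => massCurrent a b k (t, x)) hsym]
    ring
  · simp only [Complex.re_sum, Complex.re_ofReal_mul, re_conj_wVec_mul_wVec hd ha hb hau hbu]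
    refine Finset.sum_congr rfl fun k _ => Finset.sum_congr rfl fun l _ => ?_
    ring

lemma morawetzR_nonneg
    (hpos : ∀ (z : Ed n) (v : Fin n → ℝ), 0 ≤ ∑ k, ∑ l, hess h k l z * v k * v l) (t : ℝ) :
    0 ≤ morawetzR h u t := by
  refine mul_nonneg (by norm_num) (integral_nonneg fun x => integral_nonneg fun y => ?_)
  have h1 := hpos (x - y) fun k => (wVec u t x y k).re
  have h2 := hpos (x - y) fun k => (wVec u t x y k).im
  refine (add_nonneg h1 h2).trans_eq ?_
  simp only [Complex.re_sum, Complex.re_ofReal_mul, ← Finset.sum_add_distrib]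
  refine Finset.sum_congr rfl fun k _ => Finset.sum_congr rfl fun l _ => ?_
  rw [Complex.mul_re, Complex.conj_re, Complex.conj_im]
  ring

end Morawetz

/-- Quadratic Morawetz identity for NLS:
`M'(t) = (1/2)⟨∇ρ, Δh ⋆ ∇ρ⟩ + ⟨ρ, Δh ⋆ (ρg(ρ) - G(ρ))⟩ + R(t)`, and `R(t) ≥ 0` if the
Hessian of `h` is everywhere positive semidefinite. -/
theorem nls_quadratic_morawetz_identity {n : ℕ} (hn : 1 ≤ n)
    (g G : ℝ → ℝ) (hg : ContDiff ℝ (⊤ : ℕ∞) g)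
    (hG : ∀ r : ℝ, G r = ∫ s in (0:ℝ)..r, g s)
    (h : Ed n → ℝ) (hsmooth : ContDiff ℝ (⊤ : ℕ∞) h) (heven : ∀ x, h (-x) = h x)
    (hbdd : ∀ i : ℕ, 1 ≤ i → ∃ C : ℝ, ∀ x, ‖iteratedFDeriv ℝ i h x‖ ≤ C)
    (u : ℝ → Ed n → ℂ) (hu : IsNLSSolution g u) :
    (∀ t : ℝ, HasDerivAt (morawetzM h u)
      ((1/2) * (∫ x, ∫ y, lapR h (x - y) *
          ∑ k, pdR k (fun z => dens u t z) x * pdR k (fun z => dens u t z) y)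
        + (∫ x, ∫ y, dens u t x * lapR h (x - y) *
            (dens u t y * g (dens u t y) - G (dens u t y)))
        + morawetzR h u t) t) ∧
    ((∀ (z : Ed n) (v : Fin n → ℝ), 0 ≤ ∑ k, ∑ l, hess h k l z * v k * v l) →
      ∀ t : ℝ, 0 ≤ morawetzR h u t) := by
  refine ⟨fun t => ?_, fun hpos t => morawetzR_nonneg hpos t⟩
  have hab := hu.isRealNLSSolution
  obtain ⟨a, hau⟩ : ∃ a : ℝ × Ed n → ℝ, a = fun p => (u p.1 p.2).re := ⟨_, rfl⟩
  obtain ⟨b, hbu⟩ : ∃ b : ℝ × Ed n → ℝ, b = fun p => (u p.1 p.2).im := ⟨_, rfl⟩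
  have hM := morawetzM_eq hsmooth hbdd hu
  rw [← hau, ← hbu] at hab hM
  have hdens : ∀ t x, dens u t x = massDensity a b (t, x) := by
    rw [hau, hbu]
    exact dens_eq_massDensity u
  have hρ := isDecaying_massDensity hab.decaying_re hab.decaying_im
  have hkk : ∀ k l : Fin n, IsSmoothBdd (hess h k l) :=
    fun k l => (isSmoothBdd_dirDeriv_of_bounded hsmooth hbdd _).dirDeriv _
  have hpdρ : ∀ (k : Fin n) (x : Ed n), pdR k (fun z => massDensity a b (t, z)) x
      = dirDeriv (spaceDir k) (massDensity a b) (t, x) :=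
    fun k x => congrFun (dirDeriv_slice hρ k t) x
  have hgrad : ∫ x, ∫ y, lapR h (x - y) *
          ∑ k, pdR k (fun z => dens u t z) x * pdR k (fun z => dens u t z) y
      = ∑ k, ∑ l, pairing (hess h k k)
          (fun x => dirDeriv (spaceDir l) (massDensity a b) (t, x))
          (fun x => dirDeriv (spaceDir l) (massDensity a b) (t, x)) := by
    refine ((HasDoubleIntegral.sum fun k => HasDoubleIntegral.sum fun l =>
      hasDoubleIntegral_pairing (hkk k k) ((hρ.dirDeriv (spaceDir l)).integrable t)
        ((hρ.dirDeriv (spaceDir l)).integrable t)).congr fun x y => ?_).integral_integral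
    simp only [hdens, hpdρ, lapR, Finset.sum_mul, Finset.mul_sum]
    rw [Finset.sum_comm]
    refine Finset.sum_congr rfl fun k _ => Finset.sum_congr rfl fun l _ => ?_
    rw [hess]
    ring
  have hpres : ∫ x, ∫ y, dens u t x * lapR h (x - y) *
            (dens u t y * g (dens u t y) - G (dens u t y))
      = ∑ k, pairing (hess h k k) (fun x => massDensity a b (t, x))
          (fun x => massDensity a b (t, x) * g (massDensity a b (t, x))
            - G (massDensity a b (t, x))) := by
    refine ((HasDoubleIntegral.sum fun k => hasDoubleIntegral_pairing (hkk k k)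
      (hρ.integrable t) (integrable_pressure hg.continuous hG hρ t)).congr
      fun x y => ?_).integral_integral
    simp only [hdens, lapR, Finset.mul_sum, Finset.sum_mul, hess]
  rw [show morawetzM h u = _ from funext hM, hgrad, hpres,
    morawetzR_eq hsmooth heven hbdd hu hau hbu]
  refine (HasDerivAt.fun_sum fun k _ =>
    hab.hasDerivAt_pairing hg hG hsmooth hbdd k t).fun_neg.congr_deriv ?_
  have hswap : ∑ k, ∑ l, pairing (hess h l l)
        (fun x => dirDeriv (spaceDir k) (massDensity a b) (t, x))
        (fun x => dirDeriv (spaceDir k) (massDensity a b) (t, x))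
      = ∑ k, ∑ l, pairing (hess h k k)
        (fun x => dirDeriv (spaceDir l) (massDensity a b) (t, x))
        (fun x => dirDeriv (spaceDir l) (massDensity a b) (t, x)) := Finset.sum_comm
  simp only [pairing_hess_gradient hsmooth hbdd hρ, Finset.sum_sub_distrib,
    Finset.sum_add_distrib, ← Finset.mul_sum, hswap]
  ring
end
end

section
/- Uniform bound for the Morawetz potential kernel: let n ≥ 2 and 0 < ε < 1/2, and define r₊ and r₋ by n/r₊ = n/2 - 1/2 + ε and n/r₋ = n/2 - 1/2 - ε. Then there is a constant C = C(n,ε) such that for every Schwartz function u on ℝⁿ, sup_{x ∈ ℝⁿ} ∫ |x-y|^{-1} |u(y)|² dy ≤ C ‖u‖_{L^{r₊}} ‖u‖_{L^{r₋}}. -/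
open MeasureTheory Filter Complex

noncomputable section

section RadialWeights

variable {E : Type*} [NormedAddCommGroup E] [NormedSpace ℝ E] [FiniteDimensional ℝ E]
  [MeasurableSpace E] [BorelSpace E] (μ : Measure E) [μ.IsAddHaarMeasure]

/-- Hölder's inequality for the pairing of a translated radial weight with `‖u‖ ^ 2`. -/
theorem integral_radial_mul_sq_le {F : ℝ → ℝ} (hFm : Measurable F) (hF0 : ∀ z : E, 0 ≤ F ‖z‖)
    {p q : ℝ} (hpq : q.HolderConjugate p) (hF : Integrable (fun z : E => F ‖z‖ ^ q) μ)
    {u : E → ℂ} (hu : MemLp u (ENNReal.ofReal (2 * p)) μ) (x : E) :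
    Integrable (fun y => F ‖x - y‖ * ‖u y‖ ^ 2) μ ∧
      ∫ y, F ‖x - y‖ * ‖u y‖ ^ 2 ∂μ ≤
        (∫ z, F ‖z‖ ^ q ∂μ) ^ (1 / q) *
          (eLpNorm u (ENNReal.ofReal (2 * p)) μ).toReal ^ 2 := by
  have hp := hpq.symm.pos
  have hq := hpq.pos
  have hpow : ∀ y, (‖u y‖ ^ 2) ^ p = ‖u y‖ ^ (2 * p) := fun y => by
    rw [Real.rpow_mul (norm_nonneg _), Real.rpow_two]
  have hf : MemLp (fun y => F ‖x - y‖) (ENNReal.ofReal q) μ := by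
    have hm : Measurable fun y : E => F ‖x - y‖ := by fun_prop
    rw [← integrable_norm_rpow_iff hm.aestronglyMeasurable (by simpa using hq) (by simp)]
    simpa [ENNReal.toReal_ofReal hq.le, abs_of_nonneg (hF0 _)] using hF.comp_sub_left x
  have hint : Integrable (fun y => ‖u y‖ ^ (2 * p)) μ := by
    simpa [ENNReal.toReal_ofReal, hp.le] using
      hu.integrable_norm_rpow (by simpa using hp) ENNReal.ofReal_ne_top
  have hg : MemLp (fun y => ‖u y‖ ^ 2) (ENNReal.ofReal p) μ := by
    rw [← integrable_norm_rpow_iff (hu.1.norm.fun_pow 2) (by simpa using hp) (by simp)]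
    simpa [ENNReal.toReal_ofReal hp.le, hpow] using hint
  have : ENNReal.HolderConjugate (ENNReal.ofReal q) (ENNReal.ofReal p) := hpq.ennrealOfReal
  refine ⟨hf.integrable_mul hg, (integral_mul_le_Lp_mul_Lq_of_nonneg hpq
    (.of_forall fun _ => hF0 _) (.of_forall fun _ => by positivity) hf hg).trans_eq ?_⟩
  rw [integral_sub_left_eq_self (fun z => F ‖z‖ ^ q) μ x,
    hu.eLpNorm_eq_integral_rpow_norm (by simpa using hp) ENNReal.ofReal_ne_top,
    ENNReal.toReal_ofReal (by positivity), ENNReal.toReal_ofReal (by positivity),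
    ← Real.rpow_mul_natCast (by positivity)]
  simp only [hpow]
  congr 2
  push_cast
  field_simp

variable [Nontrivial E]

/-- Polar coordinates for powers of `‖z‖⁻¹` restricted to a radial set. -/
theorem integral_indicator_inv_norm_rpow {q : ℝ} (hq : q ≠ 0) {S : Set ℝ} (hS : MeasurableSet S)
    (h : IntegrableOn (fun t : ℝ => t ^ ((Module.finrank ℝ E : ℝ) - 1 - q)) (Set.Ioi 0 ∩ S)) :
    Integrable (fun z : E => S.indicator (·⁻¹) ‖z‖ ^ q) μ ∧
      ∫ z : E, S.indicator (·⁻¹) ‖z‖ ^ q ∂μ = Module.finrank ℝ E * μ.real (Metric.ball 0 1) *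
        ∫ t in Set.Ioi 0 ∩ S, t ^ ((Module.finrank ℝ E : ℝ) - 1 - q) := by
  have key : Set.EqOn
      (fun t : ℝ => t ^ (Module.finrank ℝ E - 1) • (S.indicator (·⁻¹) t : ℝ) ^ q)
      (S.indicator fun t => t ^ ((Module.finrank ℝ E : ℝ) - 1 - q)) (Set.Ioi 0) := by
    intro t ht
    have ht : 0 < t := ht
    by_cases hts : t ∈ S
    · have hd : 1 ≤ Module.finrank ℝ E := Module.finrank_pos
      simp only [hts, Set.indicator_of_mem, smul_eq_mul]
      rw [Real.rpow_sub ht, Real.inv_rpow ht.le, ← Real.rpow_natCast, Nat.cast_sub hd,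
        div_eq_mul_inv, Nat.cast_one]
    · simp [hts, Real.zero_rpow hq]
  constructor
  · rw [integrable_fun_norm_addHaar μ (f := fun t => (S.indicator (·⁻¹) t : ℝ) ^ q),
      integrableOn_congr_fun key measurableSet_Ioi, IntegrableOn, integrable_indicator_iff hS,
      IntegrableOn, Measure.restrict_restrict hS, Set.inter_comm]
    exact h
  · rw [integral_fun_norm_addHaar μ fun t => (S.indicator (·⁻¹) t : ℝ) ^ q,
      setIntegral_congr_fun measurableSet_Ioi key, setIntegral_indicator hS]
    simp [mul_assoc]

theorem integral_inv_norm_rpow_near {q R : ℝ} (hq : 0 < q) (hqd : q < Module.finrank ℝ E)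
    (hR : 0 < R) :
    Integrable (fun z : E => (Set.Iic R).indicator (·⁻¹) ‖z‖ ^ q) μ ∧
      ∫ z : E, (Set.Iic R).indicator (·⁻¹) ‖z‖ ^ q ∂μ =
        Module.finrank ℝ E * μ.real (Metric.ball 0 1) / (Module.finrank ℝ E - q) *
          R ^ (Module.finrank ℝ E - q) := by
  have hlt : -1 < (Module.finrank ℝ E : ℝ) - 1 - q := by linarith
  have h := integral_indicator_inv_norm_rpow μ hq.ne' (measurableSet_Iic (a := R)) (by
    rw [Set.Ioi_inter_Iic]
    exact (intervalIntegral.intervalIntegrable_rpow' hlt).1)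
  refine ⟨h.1, h.2.trans ?_⟩
  rw [Set.Ioi_inter_Iic, ← intervalIntegral.integral_of_le hR.le, integral_rpow (.inl hlt),
    show (Module.finrank ℝ E : ℝ) - 1 - q + 1 = Module.finrank ℝ E - q by ring,
    Real.zero_rpow (by linarith)]
  ring

theorem integral_inv_norm_rpow_far {q R : ℝ} (hqd : Module.finrank ℝ E < q) (hR : 0 < R) :
    Integrable (fun z : E => (Set.Ioi R).indicator (·⁻¹) ‖z‖ ^ q) μ ∧
      ∫ z : E, (Set.Ioi R).indicator (·⁻¹) ‖z‖ ^ q ∂μ =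
        Module.finrank ℝ E * μ.real (Metric.ball 0 1) / (q - Module.finrank ℝ E) *
          R ^ (Module.finrank ℝ E - q) := by
  have hq : 0 < q := (Nat.cast_nonneg _).trans_lt hqd
  have hlt : (Module.finrank ℝ E : ℝ) - 1 - q < -1 := by linarith
  have hS : Set.Ioi 0 ∩ Set.Ioi R = Set.Ioi R :=
    Set.inter_eq_right.2 (Set.Ioi_subset_Ioi hR.le)
  have h := integral_indicator_inv_norm_rpow μ hq.ne' (measurableSet_Ioi (a := R)) (by
    rw [hS]
    exact integrableOn_Ioi_rpow_of_lt hlt hR)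
  refine ⟨h.1, h.2.trans ?_⟩
  rw [hS, integral_Ioi_rpow_of_lt hlt hR,
    show (Module.finrank ℝ E : ℝ) - 1 - q + 1 = Module.finrank ℝ E - q by ring,
    neg_div, ← div_neg, neg_sub]
  ring

/-- Splitting the kernel `‖x - y‖⁻¹` at radius `R`. -/
theorem exists_integral_inv_norm_mul_sq_le_split {q₁ q₂ p₁ p₂ : ℝ} (h₁ : q₁.HolderConjugate p₁)
    (h₂ : q₂.HolderConjugate p₂) (hq₁ : q₁ < Module.finrank ℝ E) (hq₂ : Module.finrank ℝ E < q₂) :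
    ∃ a b : ℝ, ∀ u : E → ℂ, MemLp u (ENNReal.ofReal (2 * p₁)) μ →
      MemLp u (ENNReal.ofReal (2 * p₂)) μ → ∀ (x : E) (R : ℝ), 0 < R →
        ∫ y, ‖x - y‖⁻¹ * ‖u y‖ ^ 2 ∂μ ≤
          a * R ^ (Module.finrank ℝ E / q₁ - 1) *
              (eLpNorm u (ENNReal.ofReal (2 * p₁)) μ).toReal ^ 2 +
            b * R ^ (Module.finrank ℝ E / q₂ - 1) *
              (eLpNorm u (ENNReal.ofReal (2 * p₂)) μ).toReal ^ 2 := by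
  refine ⟨(Module.finrank ℝ E * μ.real (Metric.ball 0 1) / (Module.finrank ℝ E - q₁)) ^ (1 / q₁),
    (Module.finrank ℝ E * μ.real (Metric.ball 0 1) / (q₂ - Module.finrank ℝ E)) ^ (1 / q₂),
    fun u hu₁ hu₂ x R hR => ?_⟩
  have hc : 0 ≤ (Module.finrank ℝ E : ℝ) * μ.real (Metric.ball (0 : E) 1) := by positivity
  have hnonneg : ∀ (S : Set ℝ) (z : E), 0 ≤ (S.indicator (·⁻¹) ‖z‖ : ℝ) := fun S z =>
    Set.indicator_apply_nonneg fun _ => by positivity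
  obtain ⟨i₁, e₁⟩ := integral_inv_norm_rpow_near μ h₁.pos hq₁ hR
  obtain ⟨i₂, e₂⟩ := integral_inv_norm_rpow_far μ hq₂ hR
  obtain ⟨j₁, b₁⟩ := integral_radial_mul_sq_le μ (measurable_inv.indicator measurableSet_Iic)
    (hnonneg _) h₁ i₁ hu₁ x
  obtain ⟨j₂, b₂⟩ := integral_radial_mul_sq_le μ (measurable_inv.indicator measurableSet_Ioi)
    (hnonneg _) h₂ i₂ hu₂ x
  rw [e₁, Real.mul_rpow (div_nonneg hc (by linarith)) (by positivity), ← Real.rpow_mul hR.le,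
    mul_one_div, sub_div, div_self h₁.ne_zero] at b₁
  rw [e₂, Real.mul_rpow (div_nonneg hc (by linarith)) (by positivity), ← Real.rpow_mul hR.le,
    mul_one_div, sub_div, div_self h₂.ne_zero] at b₂
  refine le_trans (le_of_eq ?_) (add_le_add b₁ b₂)
  rw [← integral_add j₁ j₂]
  congr with y
  rw [← add_mul, ← Set.compl_Iic, ← Pi.add_apply, Set.indicator_self_add_compl]

end RadialWeights

/-- Choosing `t = A / B` in `a t B² + b t⁻¹ A²`. -/
theorem le_mul_of_forall_le_add_rpow {I a b A B s : ℝ} (hs : 0 < s) (hA : 0 < A) (hB : 0 < B)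
    (h : ∀ R : ℝ, 0 < R → I ≤ a * R ^ s * B ^ 2 + b * R ^ (-s) * A ^ 2) :
    I ≤ (a + b) * A * B := by
  have hAB : 0 < A / B := div_pos hA hB
  refine (h ((A / B) ^ s⁻¹) (Real.rpow_pos_of_pos hAB _)).trans_eq ?_
  rw [Real.rpow_neg (by positivity), Real.rpow_inv_rpow hAB.le hs.ne']
  field_simp

/-- Uniform bound for the Morawetz potential kernel: for `n ≥ 2`,
`0 < ε < 1/2` and exponents `r₊, r₋` with `n/r₊ = n/2 - 1/2 + ε`, `n/r₋ = n/2 - 1/2 - ε`,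
one has `sup_x ∫ |x-y|⁻¹ |u(y)|² dy ≤ C ‖u‖_{r₊} ‖u‖_{r₋}` for Schwartz `u`. -/
theorem morawetz_potential_kernel_bound {n : ℕ} (hn : 2 ≤ n)
    (ε rp rm : ℝ) (hε0 : 0 < ε) (hε : ε < 1/2)
    (hrp : (n : ℝ) / rp = n / 2 - 1/2 + ε)
    (hrm : (n : ℝ) / rm = n / 2 - 1/2 - ε) :
    ∃ C : ℝ, ∀ u : SchwartzMap (Ed n) ℂ, ∀ x : Ed n,
      (∫ y, ‖x - y‖⁻¹ * ‖u y‖ ^ 2) ≤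
        C * (eLpNorm (⇑u) (ENNReal.ofReal rp) volume).toReal
          * (eLpNorm (⇑u) (ENNReal.ofReal rm) volume).toReal := by
  have hn0 : (0 : ℝ) < n := by positivity
  have hn2 : (2 : ℝ) ≤ n := by exact_mod_cast hn
  have : Nonempty (Fin n) := ⟨⟨0, by omega⟩⟩
  have hrp0 : rp ≠ 0 := by
    rintro rfl
    rw [div_zero] at hrp
    linarith
  have hrm0 : rm ≠ 0 := by
    rintro rfl
    rw [div_zero] at hrm
    linarith
  have hrp_pos : 0 < rp := (div_pos_iff_of_pos_left hn0).1 (by rw [hrp]; linarith)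
  have hrm_pos : 0 < rm := (div_pos_iff_of_pos_left hn0).1 (by rw [hrm]; linarith)
  have hminus : (n / (1 + 2 * ε)).HolderConjugate (rm / 2) := by
    refine ⟨?_, by positivity, by positivity⟩
    rw [div_eq_iff hrm0] at hrm
    field_simp
    linarith
  have hplus : (n / (1 - 2 * ε)).HolderConjugate (rp / 2) := by
    have : 0 < 1 - 2 * ε := by linarith
    refine ⟨?_, by positivity, by positivity⟩
    rw [div_eq_iff hrp0] at hrp
    field_simp
    linarith
  have hfin : Module.finrank ℝ (Ed n) = n := by simp
  obtain ⟨a, b, hab⟩ := exists_integral_inv_norm_mul_sq_le_split (volume : Measure (Ed n))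
    hminus hplus (by rw [hfin]; exact div_lt_self hn0 (by linarith))
    (by rw [hfin, lt_div_iff₀ (by linarith)]; nlinarith)
  simp only [hfin, mul_div_cancel₀ _ (two_ne_zero' ℝ), div_div_cancel₀ hn0.ne',
    add_sub_cancel_left, show 1 - 2 * ε - 1 = -(2 * ε) by ring] at hab
  refine ⟨a + b, fun u x => ?_⟩
  rcases eq_or_ne u 0 with rfl | hu
  · simp
  have hpos : ∀ r : ℝ, 0 < r → 0 < (eLpNorm u (ENNReal.ofReal r) volume).toReal := by
    intro r hr
    have hmem : MemLp u (ENNReal.ofReal r) volume := u.memLp _ _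
    refine ENNReal.toReal_pos (fun h => hu ?_) hmem.eLpNorm_ne_top
    have h0 : u =ᵐ[volume] (fun _ => 0 : Ed n → ℂ) :=
      (eLpNorm_eq_zero_iff u.continuous.aestronglyMeasurable (by simpa using hr)).1 h
    exact DFunLike.coe_injective ((u.continuous.ae_eq_iff_eq volume continuous_const).1 h0)
  exact le_mul_of_forall_le_add_rpow (by linarith) (hpos rp hrp_pos) (hpos rm hrm_pos)
    (hab u (u.memLp _) (u.memLp _) x)
end
end
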